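/- arXiv:1104.4223 — 8 statements merged into one kernel-verified Lean document; each statement's English description precedes it below -/
import Mathlib

section
/- Let θ: ℝ₊ → ℝ₊ be a ccc function and let (φ, ψ) and (φ̃, ψ̃) be two factorizations of θ that are both minimal, i.e. φ⁻¹ ∘ φ̃ and φ̃⁻¹ ∘ φ are both convex. Then there exists λ ∈ (0, ∞) such that φ̃(t) = φ(λt) and ψ̃(t) = ψ(t)/λ for all t ∈ ℝ₊. In other words, two minimal factorizations of a given ccc function differ only by a linear change of variables. -/
open Set Function

/-- A convex-concave factorization of `θ`: `θ = φ ∘ ψ` on `ℝ₊` where `φ, ψ : ℝ₊ → ℝ₊` are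
strictly increasing and continuous with `φ 0 = ψ 0 = 0`, `φ` convex and `ψ` concave. -/
structure CCFactorization (θ φ ψ : ℝ → ℝ) : Prop where
  phi_strictMono : StrictMonoOn φ (Set.Ici 0)
  phi_continuous : ContinuousOn φ (Set.Ici 0)
  phi_zero : φ 0 = 0
  phi_mapsTo : Set.MapsTo φ (Set.Ici 0) (Set.Ici 0)
  phi_convex : ConvexOn ℝ (Set.Ici 0) φ
  psi_strictMono : StrictMonoOn ψ (Set.Ici 0)
  psi_continuous : ContinuousOn ψ (Set.Ici 0)
  psi_zero : ψ 0 = 0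
  psi_mapsTo : Set.MapsTo ψ (Set.Ici 0) (Set.Ici 0)
  psi_concave : ConcaveOn ℝ (Set.Ici 0) ψ
  eq_comp : ∀ x ∈ Set.Ici (0:ℝ), θ x = φ (ψ x)

/-- A convex function on `ℝ₊` vanishing at `0` is subhomogeneous for factors in `[0, 1]`. -/
theorem ConvexOn.map_mul_le_mul_of_map_zero {f : ℝ → ℝ} (hf : ConvexOn ℝ (Ici 0) f)
    (hf0 : f 0 = 0) {c x : ℝ} (hc : 0 ≤ c) (hc1 : c ≤ 1) (hx : 0 ≤ x) :
    f (c * x) ≤ c * f x := by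
  have h := hf.2 (mem_Ici.2 hx) (mem_Ici.2 le_rfl) hc (sub_nonneg.2 hc1) (by ring)
  simpa [hf0] using h

/-- A continuous, strictly increasing, convex function on `ℝ₊` vanishing at `0` is onto `ℝ₊`. -/
theorem ConvexOn.surjOn_Ici_of_strictMonoOn {f : ℝ → ℝ} (hf : ConvexOn ℝ (Ici 0) f)
    (hf0 : f 0 = 0) (hmono : StrictMonoOn f (Ici 0)) (hcont : ContinuousOn f (Ici 0)) :
    SurjOn f (Ici 0) (Ici 0) := by
  intro y hy
  have hy : 0 ≤ y := hy
  have h1 : 0 < f 1 := by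
    simpa [hf0] using hmono (mem_Ici.2 le_rfl) (mem_Ici.2 zero_le_one) zero_lt_one
  set x := y / f 1 + 1
  have hx1 : 1 ≤ x := le_add_of_nonneg_left (by positivity)
  have hx : 0 < x := zero_lt_one.trans_le hx1
  have hyx : y ≤ f x := by
    have h := hf.map_mul_le_mul_of_map_zero hf0 (inv_nonneg.2 hx.le) (inv_le_one_of_one_le₀ hx1)
      hx.le
    rw [inv_mul_cancel₀ hx.ne', ← div_eq_inv_mul, le_div_iff₀ hx] at h
    have : f 1 * x = y + f 1 := by simp only [x]; field_simp
    linarith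
  obtain ⟨z, hz, rfl⟩ := intermediate_value_Icc hx.le (hcont.mono Icc_subset_Ici_self)
    ⟨hf0.trans_le hy, hyx⟩
  exact ⟨z, hz.1, rfl⟩

/-- Mutually inverse increasing convex functions on `ℝ₊` vanishing at `0` are linear. -/
theorem ConvexOn.eq_mul_of_inverse {f g : ℝ → ℝ} (hf : ConvexOn ℝ (Ici 0) f)
    (hg : ConvexOn ℝ (Ici 0) g) (hf0 : f 0 = 0) (hg0 : g 0 = 0)
    (hfm : MapsTo f (Ici 0) (Ici 0)) (hgm : MapsTo g (Ici 0) (Ici 0))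
    (hmono : MonotoneOn f (Ici 0))
    (hgf : LeftInvOn g f (Ici 0)) (hfg : LeftInvOn f g (Ici 0)) {t : ℝ} (ht : 0 ≤ t) :
    f t = f 1 * t := by
  have key : ∀ c x : ℝ, 0 ≤ c → c ≤ 1 → 0 ≤ x → f (c * x) = c * f x := by
    intro c x hc hc1 hx
    have hfx : 0 ≤ f x := hfm hx
    have hcfx : c * f x ∈ Ici (0 : ℝ) := mul_nonneg hc hfx
    refine le_antisymm (hf.map_mul_le_mul_of_map_zero hf0 hc hc1 hx) ?_
    have h := hg.map_mul_le_mul_of_map_zero hg0 hc hc1 hfx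
    rw [hgf hx] at h
    simpa [hfg hcfx] using hmono (hgm hcfx) (mul_nonneg hc hx) h
  rcases le_total t 1 with h | h
  · simpa [mul_comm] using key t 1 ht h zero_le_one
  · have ht' : 0 < t := zero_lt_one.trans_le h
    have := key t⁻¹ t (inv_nonneg.2 ht) (inv_le_one_of_one_le₀ h) ht
    rw [inv_mul_cancel₀ ht'.ne'] at this
    rw [this]
    field_simp

namespace CCFactorization

theorem bijOn_phi {θ φ ψ : ℝ → ℝ} (h : CCFactorization θ φ ψ) : BijOn φ (Ici 0) (Ici 0) :=
  ⟨h.phi_mapsTo, h.phi_strictMono.injOn,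
    h.phi_convex.surjOn_Ici_of_strictMonoOn h.phi_zero h.phi_strictMono h.phi_continuous⟩

end CCFactorization

/-- Two minimal factorizations of a given ccc function differ only by a linear change of
variables: if `(φ, ψ)` and `(φ̃, ψ̃)` are factorizations of `θ` such that both `φ⁻¹ ∘ φ̃` and
`φ̃⁻¹ ∘ φ` are convex, then there is `λ ∈ (0,∞)` with `φ̃ t = φ (λ t)` and `ψ̃ t = ψ t / λ`. -/
theorem minimal_factorizations_differ_by_linear_change
    (θ φ ψ φt ψt : ℝ → ℝ)
    (h1 : CCFactorization θ φ ψ) (h2 : CCFactorization θ φt ψt)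
    (hmin1 : ConvexOn ℝ (Set.Ici 0) (fun x => Function.invFunOn φ (Set.Ici 0) (φt x)))
    (hmin2 : ConvexOn ℝ (Set.Ici 0) (fun x => Function.invFunOn φt (Set.Ici 0) (φ x))) :
    ∃ lam : ℝ, 0 < lam ∧
      ∀ t : ℝ, 0 ≤ t → φt t = φ (lam * t) ∧ ψt t = ψ t / lam := by
  have b1 := h1.bijOn_phi
  have b2 := h2.bijOn_phi
  have i1 := b1.invOn_invFunOn
  have i2 := b2.invOn_invFunOn
  have m1 := b1.surjOn.mapsTo_invFunOn
  have m2 := b2.surjOn.mapsTo_invFunOn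
  have z : (0 : ℝ) ∈ Ici (0 : ℝ) := mem_Ici.2 le_rfl
  set f := fun x => invFunOn φ (Ici 0) (φt x) with hf
  set g := fun x => invFunOn φt (Ici 0) (φ x) with hg
  have hφf : ∀ t ∈ Ici (0 : ℝ), φ (f t) = φt t := fun t ht => i1.2 (b2.mapsTo ht)
  have hfm : MapsTo f (Ici 0) (Ici 0) := m1.comp b2.mapsTo
  have hgm : MapsTo g (Ici 0) (Ici 0) := m2.comp b1.mapsTo
  have hgf : LeftInvOn g f (Ici 0) := fun t ht => by
    simp only [hg, hφf t ht]; exact i2.1 ht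
  have hfg : LeftInvOn f g (Ici 0) := fun t ht => by
    have : φt (g t) = φ t := i2.2 (b1.mapsTo ht)
    simp only [hf, this]; exact i1.1 ht
  have hf0 : f 0 = 0 := b1.injOn (hfm z) z (by rw [hφf 0 z, h1.phi_zero, h2.phi_zero])
  have hg0 : g 0 = 0 := by simpa [hf0] using hgf z
  have hmono : StrictMonoOn f (Ici 0) := fun a ha b hb hab => by
    rw [← h1.phi_strictMono.lt_iff_lt (hfm ha) (hfm hb), hφf a ha, hφf b hb]
    exact h2.phi_strictMono ha hb hab
  have hlin : ∀ t : ℝ, 0 ≤ t → f t = f 1 * t := fun t ht =>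
    hmin1.eq_mul_of_inverse hmin2 hf0 hg0 hfm hgm hmono.monotoneOn hgf hfg ht
  have hpos : 0 < f 1 := by simpa [hf0] using hmono z (mem_Ici.2 zero_le_one) zero_lt_one
  refine ⟨f 1, hpos, fun t ht => ⟨by rw [← hlin t ht, hφf t ht], ?_⟩⟩
  have hψ : 0 ≤ ψt t := h2.psi_mapsTo ht
  have h : ψ t = f (ψt t) := b1.injOn (h1.psi_mapsTo ht) (hfm hψ) (by
    rw [hφf _ hψ, ← h1.eq_comp t ht, h2.eq_comp t ht])
  rw [h, hlin _ hψ, mul_div_cancel_left₀ _ hpos.ne']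
end

section
/- Let (X, Ξ, μ) be a σ-finite measure space, φ, ψ: ℝ₊ → ℝ₊ strictly increasing continuous with φ(0) = ψ(0) = 0, φ convex, ψ concave. Let f, g, h: X → ℝ be measurable and r, s ∈ (0, ∞) be such that ∫_X φ( ψ(|f−g|)/r ) dμ ≤ 1 and ∫_X φ( ψ(|g−h|)/s ) dμ ≤ 1. Then ∫_X φ( ψ(|f−h|)/(r+s) ) dμ ≤ 1. -/
open Set Function MeasureTheory
open scoped ENNReal

/-- A concave function on `[0, ∞)` that is nonnegative at `0` is subadditive. -/
theorem ConcaveOn.map_add_le_add_of_nonneg {ψ : ℝ → ℝ} (hψ : ConcaveOn ℝ (Ici 0) ψ)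
    (h0 : 0 ≤ ψ 0) {a b : ℝ} (ha : 0 ≤ a) (hb : 0 ≤ b) : ψ (a + b) ≤ ψ a + ψ b := by
  rcases (add_nonneg ha hb).eq_or_lt with hab | hab
  · obtain rfl : a = 0 := by linarith
    obtain rfl : b = 0 := by linarith
    simpa using h0
  · have key : ∀ {u v : ℝ}, 0 ≤ u → 0 ≤ v → u + v = a + b →
        u / (a + b) * ψ (a + b) ≤ ψ u := by
      intro u v hu hv huv
      have hsum : u / (a + b) + v / (a + b) = 1 := by
        rw [← add_div, huv, div_self hab.ne']
      have h := hψ.2 (mem_Ici.2 hab.le) self_mem_Ici (div_nonneg hu hab.le)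
        (div_nonneg hv hab.le) hsum
      simp only [smul_eq_mul, mul_zero, add_zero, div_mul_cancel₀ _ hab.ne'] at h
      have := mul_nonneg (div_nonneg hv hab.le) h0
      linarith
    calc ψ (a + b) = a / (a + b) * ψ (a + b) + b / (a + b) * ψ (a + b) := by
          rw [← add_mul, ← add_div, div_self hab.ne', one_mul]
      _ ≤ ψ a + ψ b := add_le_add (key ha hb rfl) (key hb ha (add_comm b a))

/-- Pointwise convexity estimate: the value of `φ` at a mediant is bounded by the
corresponding convex combination. -/
theorem ConvexOn.map_add_div_add_le {φ : ℝ → ℝ} (hφ : ConvexOn ℝ (Ici 0) φ) {p q r s : ℝ}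
    (hp : 0 ≤ p) (hq : 0 ≤ q) (hr : 0 < r) (hs : 0 < s) :
    φ ((p + q) / (r + s)) ≤ r / (r + s) * φ (p / r) + s / (r + s) * φ (q / s) := by
  have h := hφ.2 (mem_Ici.2 (div_nonneg hp hr.le)) (mem_Ici.2 (div_nonneg hq hs.le))
    (div_nonneg hr.le (add_pos hr hs).le) (div_nonneg hs.le (add_pos hr hs).le)
    (by rw [← add_div, div_self (add_pos hr hs).ne'])
  have e : (p + q) / (r + s) = r / (r + s) * (p / r) + s / (r + s) * (q / s) := by
    field_simp
  rw [e]
  simpa only [smul_eq_mul] using h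

theorem measurable_comp_abs_of_monotoneOn {X : Type*} [MeasurableSpace X] {θ : ℝ → ℝ}
    (hθ : MonotoneOn θ (Ici 0)) {u : X → ℝ} (hu : Measurable u) :
    Measurable fun x => θ |u x| := by
  have hmono : Monotone fun t => θ (max t 0) := fun a b hab =>
    hθ (le_max_right a 0) (le_max_right b 0) (max_le_max_right 0 hab)
  simpa [Function.comp_def] using hmono.measurable.comp hu.abs

/-- Key estimate for the triangle inequality of `d_θ`: if
`∫ φ(ψ(|f−g|)/r) dμ ≤ 1` and `∫ φ(ψ(|g−h|)/s) dμ ≤ 1`, then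
`∫ φ(ψ(|f−h|)/(r+s)) dμ ≤ 1`. -/
theorem lintegral_ccc_triangle_estimate
    {X : Type*} [MeasurableSpace X] (μ : Measure X) [SigmaFinite μ]
    (φ ψ : ℝ → ℝ)
    (hφ_mono : StrictMonoOn φ (Set.Ici 0))
    (hφ_cont : ContinuousOn φ (Set.Ici 0))
    (hφ_zero : φ 0 = 0)
    (hφ_maps : Set.MapsTo φ (Set.Ici 0) (Set.Ici 0))
    (hφ_convex : ConvexOn ℝ (Set.Ici 0) φ)
    (hψ_mono : StrictMonoOn ψ (Set.Ici 0))
    (hψ_cont : ContinuousOn ψ (Set.Ici 0))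
    (hψ_zero : ψ 0 = 0)
    (hψ_maps : Set.MapsTo ψ (Set.Ici 0) (Set.Ici 0))
    (hψ_concave : ConcaveOn ℝ (Set.Ici 0) ψ)
    (f g k : X → ℝ) (hf : Measurable f) (hg : Measurable g) (hk : Measurable k)
    (r s : ℝ) (hr : 0 < r) (hs : 0 < s)
    (h1 : ∫⁻ x, ENNReal.ofReal (φ (ψ |f x - g x| / r)) ∂μ ≤ 1)
    (h2 : ∫⁻ x, ENNReal.ofReal (φ (ψ |g x - k x| / s)) ∂μ ≤ 1) :
    ∫⁻ x, ENNReal.ofReal (φ (ψ |f x - k x| / (r + s))) ∂μ ≤ 1 := by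
  have hψ_nonneg : ∀ t : ℝ, 0 ≤ ψ |t| := fun t => hψ_maps (abs_nonneg t)
  have hrs : 0 < r + s := add_pos hr hs
  have hθ : MonotoneOn (fun t => φ (ψ t / r)) (Ici 0) := fun a ha b hb hab =>
    hφ_mono.monotoneOn (div_nonneg (hψ_maps ha) hr.le) (div_nonneg (hψ_maps hb) hr.le)
      (div_le_div_of_nonneg_right (hψ_mono.monotoneOn ha hb hab) hr.le)
  have hmeas : Measurable fun x => ENNReal.ofReal (φ (ψ |f x - g x| / r)) :=
    (measurable_comp_abs_of_monotoneOn hθ (hf.sub hg)).ennreal_ofReal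
  have hψ_triangle : ∀ x, ψ |f x - k x| ≤ ψ |f x - g x| + ψ |g x - k x| := fun x =>
    (hψ_mono.monotoneOn (mem_Ici.2 (abs_nonneg _))
      (mem_Ici.2 (add_nonneg (abs_nonneg _) (abs_nonneg _))) (abs_sub_le _ _ _)).trans
      (hψ_concave.map_add_le_add_of_nonneg hψ_zero.ge (abs_nonneg _) (abs_nonneg _))
  have hpoint : ∀ x, ENNReal.ofReal (φ (ψ |f x - k x| / (r + s))) ≤
      ENNReal.ofReal (r / (r + s)) * ENNReal.ofReal (φ (ψ |f x - g x| / r)) +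
        ENNReal.ofReal (s / (r + s)) * ENNReal.ofReal (φ (ψ |g x - k x| / s)) := by
    intro x
    have hle : φ (ψ |f x - k x| / (r + s)) ≤
        φ ((ψ |f x - g x| + ψ |g x - k x|) / (r + s)) :=
      hφ_mono.monotoneOn (div_nonneg (hψ_nonneg _) hrs.le)
        (div_nonneg (add_nonneg (hψ_nonneg _) (hψ_nonneg _)) hrs.le)
        (div_le_div_of_nonneg_right (hψ_triangle x) hrs.le)
    rw [← ENNReal.ofReal_mul (div_nonneg hr.le hrs.le),
      ← ENNReal.ofReal_mul (div_nonneg hs.le hrs.le)]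
    exact (ENNReal.ofReal_le_ofReal (hle.trans
      (hφ_convex.map_add_div_add_le (hψ_nonneg _) (hψ_nonneg _) hr hs))).trans
      ENNReal.ofReal_add_le
  calc ∫⁻ x, ENNReal.ofReal (φ (ψ |f x - k x| / (r + s))) ∂μ
      ≤ _ := lintegral_mono hpoint
    _ = ENNReal.ofReal (r / (r + s)) * ∫⁻ x, ENNReal.ofReal (φ (ψ |f x - g x| / r)) ∂μ +
        ENNReal.ofReal (s / (r + s)) * ∫⁻ x, ENNReal.ofReal (φ (ψ |g x - k x| / s)) ∂μ := by
      rw [lintegral_add_left (hmeas.const_mul _), lintegral_const_mul' _ _ ENNReal.ofReal_ne_top,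
        lintegral_const_mul' _ _ ENNReal.ofReal_ne_top]
    _ ≤ ENNReal.ofReal (r / (r + s)) * 1 + ENNReal.ofReal (s / (r + s)) * 1 := by gcongr
    _ = 1 := by
      rw [mul_one, mul_one, ← ENNReal.ofReal_add (div_nonneg hr.le hrs.le)
        (div_nonneg hs.le hrs.le), ← add_div, div_self hrs.ne', ENNReal.ofReal_one]
end

section
/- Let (X, Ξ, μ) be a σ-finite measure space and (φ, ψ) a convex-concave factorization of a ccc function θ. Then d_θ satisfies the triangle inequality: for all measurable functions f, g, h: X → ℝ, d_θ(f, h) ≤ d_θ(f, g) + d_θ(g, h). -/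
open Set Function MeasureTheory
open scoped ENNReal

/-- The generalized Orlicz distance
`d_θ(f,g) = inf { t ∈ (0,∞) : ∫ φ(ψ(|f−g|)/t) dμ ≤ 1 }` (with value `∞` if no such `t` exists). -/
noncomputable def dTheta {X : Type*} [MeasurableSpace X] (μ : Measure X)
    (φ ψ : ℝ → ℝ) (f g : X → ℝ) : ℝ≥0∞ :=
  sInf {t : ℝ≥0∞ | 0 < t ∧ t ≠ ⊤ ∧
    ∫⁻ x, ENNReal.ofReal (φ (ψ |f x - g x| / t.toReal)) ∂μ ≤ 1}

/-- A concave function on `[0,∞)` vanishing at `0` is subadditive. -/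
lemma ConcaveOn.subadditive_of_zero {ψ : ℝ → ℝ} (hψ : ConcaveOn ℝ (Set.Ici 0) ψ) (h0 : ψ 0 = 0)
    {a b : ℝ} (ha : 0 ≤ a) (hb : 0 ≤ b) : ψ (a + b) ≤ ψ a + ψ b := by
  rcases (add_nonneg ha hb).eq_or_lt with h | h
  · have ha' : a = 0 := by linarith
    have hb' : b = 0 := by linarith
    simp [ha', hb', h0]
  · have hsum : a / (a + b) + b / (a + b) = 1 := by field_simp
    have h1 := hψ.2 (mem_Ici.2 h.le) (mem_Ici.2 le_rfl) (by positivity : 0 ≤ a / (a + b))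
      (by positivity : 0 ≤ b / (a + b)) hsum
    have h2 := hψ.2 (mem_Ici.2 le_rfl) (mem_Ici.2 h.le) (by positivity : 0 ≤ a / (a + b))
      (by positivity : 0 ≤ b / (a + b)) hsum
    simp only [smul_eq_mul, h0, mul_zero, add_zero, zero_add] at h1 h2
    rw [div_mul_cancel₀ _ h.ne'] at h1 h2
    have h3 : a / (a + b) * ψ (a + b) + b / (a + b) * ψ (a + b) = ψ (a + b) := by
      rw [← add_mul, hsum, one_mul]
    linarith

/-- The perspective inequality for a convex function on `[0,∞)`. -/
lemma ConvexOn.map_add_div_add_le_s4 {φ : ℝ → ℝ} (hφ : ConvexOn ℝ (Set.Ici 0) φ)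
    {a b s t : ℝ} (ha : 0 ≤ a) (hb : 0 ≤ b) (hs : 0 < s) (ht : 0 < t) :
    φ ((a + b) / (s + t)) ≤ s / (s + t) * φ (a / s) + t / (s + t) * φ (b / t) := by
  have h := hφ.2 (mem_Ici.2 (by positivity : 0 ≤ a / s)) (mem_Ici.2 (by positivity : 0 ≤ b / t))
    (by positivity : 0 ≤ s / (s + t)) (by positivity : 0 ≤ t / (s + t)) (by field_simp)
  simp only [smul_eq_mul] at h
  have e : s / (s + t) * (a / s) + t / (s + t) * (b / t) = (a + b) / (s + t) := by field_simp
  rwa [e] at h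

namespace CCFactorization

variable {θ φ ψ : ℝ → ℝ}

lemma phi_psi_abs_sub_le (h : CCFactorization θ φ ψ) (a b c : ℝ) {s t : ℝ}
    (hs : 0 < s) (ht : 0 < t) :
    φ (ψ |a - c| / (s + t)) ≤
      s / (s + t) * φ (ψ |a - b| / s) + t / (s + t) * φ (ψ |b - c| / t) := by
  have hψ (x : ℝ) : 0 ≤ ψ |x| := h.psi_mapsTo (abs_nonneg x)
  have hle : ψ |a - c| ≤ ψ |a - b| + ψ |b - c| :=
    (h.psi_strictMono.monotoneOn (mem_Ici.2 (abs_nonneg _)) (mem_Ici.2 (by positivity))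
      (abs_sub_le a b c)).trans
      (h.psi_concave.subadditive_of_zero h.psi_zero (abs_nonneg _) (abs_nonneg _))
  have h0 := hψ (a - c)
  have h1 := hψ (a - b)
  have h2 := hψ (b - c)
  refine le_trans (h.phi_strictMono.monotoneOn (mem_Ici.2 (by positivity))
    (mem_Ici.2 (by positivity)) ?_) (h.phi_convex.map_add_div_add_le_s4 h1 h2 hs ht)
  gcongr

lemma continuous_phi_psi_abs_div (h : CCFactorization θ φ ψ) {s : ℝ} (hs : 0 < s) :
    Continuous fun x : ℝ => φ (ψ |x| / s) := by
  have hψ : Continuous fun x : ℝ => ψ |x| :=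
    h.psi_continuous.comp_continuous continuous_abs fun x => abs_nonneg x
  exact h.phi_continuous.comp_continuous (hψ.div_const s) fun x =>
    div_nonneg (h.psi_mapsTo (abs_nonneg x)) hs.le

lemma lintegral_phi_psi_add_le_one {X : Type*} [MeasurableSpace X] {μ : Measure X}
    (h : CCFactorization θ φ ψ) {f g k : X → ℝ} (hf : Measurable f) (hg : Measurable g)
    {s t : ℝ} (hs : 0 < s) (ht : 0 < t)
    (hfg : ∫⁻ x, ENNReal.ofReal (φ (ψ |f x - g x| / s)) ∂μ ≤ 1)
    (hgk : ∫⁻ x, ENNReal.ofReal (φ (ψ |g x - k x| / t)) ∂μ ≤ 1) :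
    ∫⁻ x, ENNReal.ofReal (φ (ψ |f x - k x| / (s + t))) ∂μ ≤ 1 := by
  have hs' : 0 ≤ s / (s + t) := by positivity
  have ht' : 0 ≤ t / (s + t) := by positivity
  have hmeas : Measurable fun x => ENNReal.ofReal (φ (ψ |f x - g x| / s)) :=
    ((h.continuous_phi_psi_abs_div hs).measurable.comp (hf.sub hg)).ennreal_ofReal
  calc ∫⁻ x, ENNReal.ofReal (φ (ψ |f x - k x| / (s + t))) ∂μ
      ≤ ∫⁻ x, (ENNReal.ofReal (s / (s + t)) * ENNReal.ofReal (φ (ψ |f x - g x| / s)) +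
          ENNReal.ofReal (t / (s + t)) * ENNReal.ofReal (φ (ψ |g x - k x| / t))) ∂μ := by
        refine lintegral_mono fun x => ?_
        rw [← ENNReal.ofReal_mul hs', ← ENNReal.ofReal_mul ht']
        exact (ENNReal.ofReal_le_ofReal (h.phi_psi_abs_sub_le _ (g x) _ hs ht)).trans
          ENNReal.ofReal_add_le
    _ = ENNReal.ofReal (s / (s + t)) * ∫⁻ x, ENNReal.ofReal (φ (ψ |f x - g x| / s)) ∂μ +
          ENNReal.ofReal (t / (s + t)) * ∫⁻ x, ENNReal.ofReal (φ (ψ |g x - k x| / t)) ∂μ := by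
        rw [lintegral_add_left (hmeas.const_mul _), lintegral_const_mul _ hmeas,
          lintegral_const_mul' _ _ ENNReal.ofReal_ne_top]
    _ ≤ ENNReal.ofReal (s / (s + t)) * 1 + ENNReal.ofReal (t / (s + t)) * 1 := by gcongr
    _ = 1 := by
        rw [mul_one, mul_one, ← ENNReal.ofReal_add hs' ht', ← add_div,
          div_self (add_pos hs ht).ne', ENNReal.ofReal_one]

end CCFactorization

/-- The triangle inequality for `d_θ`. -/
theorem dTheta_triangle
    {X : Type*} [MeasurableSpace X] (μ : Measure X) [SigmaFinite μ]
    (θ φ ψ : ℝ → ℝ) (hfact : CCFactorization θ φ ψ)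
    (f g k : X → ℝ) (hf : Measurable f) (hg : Measurable g) (hk : Measurable k) :
    dTheta μ φ ψ f k ≤ dTheta μ φ ψ f g + dTheta μ φ ψ g k := by
  unfold dTheta
  rw [sInf_eq_iInf' {t : ℝ≥0∞ | 0 < t ∧ t ≠ ⊤ ∧
      ∫⁻ x, ENNReal.ofReal (φ (ψ |f x - g x| / t.toReal)) ∂μ ≤ 1},
    sInf_eq_iInf' {t : ℝ≥0∞ | 0 < t ∧ t ≠ ⊤ ∧
      ∫⁻ x, ENNReal.ofReal (φ (ψ |g x - k x| / t.toReal)) ∂μ ≤ 1}]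
  refine ENNReal.le_iInf_add_iInf ?_
  rintro ⟨s, hs, hs', hfg⟩ ⟨t, ht, ht', hgk⟩
  refine sInf_le ⟨add_pos_of_pos_of_nonneg hs ht.le, ENNReal.add_ne_top.2 ⟨hs', ht'⟩, ?_⟩
  rw [ENNReal.toReal_add hs' ht']
  exact hfact.lintegral_phi_psi_add_le_one hf hg (ENNReal.toReal_pos hs.ne' hs')
    (ENNReal.toReal_pos ht.ne' ht') hfg hgk
end

section
/- Let (X, Ξ, μ) be a σ-finite measure space and (φ, ψ) a convex-concave factorization of a ccc function θ. Then the metric space (L^θ(X, μ), d_θ) is complete: for every sequence (f_n) of measurable functions in L^θ(X, μ) which is Cauchy with respect to d_θ, there exists a measurable function f ∈ L^θ(X, μ) with d_θ(f_n, f) → 0 as n → ∞. -/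
open Set Function MeasureTheory Filter
open scoped ENNReal Topology

/-- Membership in the generalized Orlicz space `L^θ(X,μ)`:
`∫ φ(ψ(|f|)/t) dμ < ∞` for some `t ∈ (0,∞)`. -/
def MemLTheta {X : Type*} [MeasurableSpace X] (μ : Measure X)
    (φ ψ : ℝ → ℝ) (f : X → ℝ) : Prop :=
  ∃ t : ℝ, 0 < t ∧ ∫⁻ x, ENNReal.ofReal (φ (ψ |f x| / t)) ∂μ < ⊤

namespace CCFactorization

variable {θ φ ψ : ℝ → ℝ}

lemma phi_nonneg (h : CCFactorization θ φ ψ) {x : ℝ} (hx : 0 ≤ x) : 0 ≤ φ x :=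
  h.phi_mapsTo hx

lemma psi_nonneg (h : CCFactorization θ φ ψ) {x : ℝ} (hx : 0 ≤ x) : 0 ≤ ψ x :=
  h.psi_mapsTo hx

lemma phi_mono (h : CCFactorization θ φ ψ) {x y : ℝ} (hx : 0 ≤ x) (hxy : x ≤ y) : φ x ≤ φ y :=
  h.phi_strictMono.monotoneOn hx (hx.trans hxy) hxy

lemma psi_mono (h : CCFactorization θ φ ψ) {x y : ℝ} (hx : 0 ≤ x) (hxy : x ≤ y) : ψ x ≤ ψ y :=
  h.psi_strictMono.monotoneOn hx (hx.trans hxy) hxy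

lemma phi_mul_le (h : CCFactorization θ φ ψ) {c x : ℝ} (hc : 0 ≤ c) (hc' : c ≤ 1) (hx : 0 ≤ x) :
    φ (c * x) ≤ c * φ x := by
  have := h.phi_convex.2 (mem_Ici.2 hx) (mem_Ici.2 le_rfl) hc (sub_nonneg.2 hc')
    (add_sub_cancel c 1)
  simpa [h.phi_zero] using this

lemma mul_psi_le (h : CCFactorization θ φ ψ) {c x : ℝ} (hc : 0 ≤ c) (hc' : c ≤ 1) (hx : 0 ≤ x) :
    c * ψ x ≤ ψ (c * x) := by
  have := h.psi_concave.2 (mem_Ici.2 hx) (mem_Ici.2 le_rfl) hc (sub_nonneg.2 hc')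
    (add_sub_cancel c 1)
  simpa [h.psi_zero] using this

lemma psi_add_le (h : CCFactorization θ φ ψ) {a b : ℝ} (ha : 0 ≤ a) (hb : 0 ≤ b) :
    ψ (a + b) ≤ ψ a + ψ b := by
  rcases (add_nonneg ha hb).eq_or_lt with h0 | h0
  · rw [← h0, h.psi_zero]
    exact add_nonneg (h.psi_nonneg ha) (h.psi_nonneg hb)
  · have h1 := h.mul_psi_le (div_nonneg ha h0.le) (div_le_one_of_le₀ (by linarith) h0.le) h0.le
    have h2 := h.mul_psi_le (div_nonneg hb h0.le) (div_le_one_of_le₀ (by linarith) h0.le) h0.le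
    rw [div_mul_cancel₀ _ h0.ne'] at h1 h2
    calc ψ (a + b) = a / (a + b) * ψ (a + b) + b / (a + b) * ψ (a + b) := by field_simp
      _ ≤ ψ a + ψ b := add_le_add h1 h2

lemma exists_le_phi (h : CCFactorization θ φ ψ) (C : ℝ) : ∃ M, 0 < M ∧ C ≤ φ M := by
  have h1 : 0 < φ 1 := by
    simpa [h.phi_zero] using h.phi_strictMono (mem_Ici.2 le_rfl) (mem_Ici.2 zero_le_one) zero_lt_one
  set M := max 1 (C / φ 1)
  have hM : 1 ≤ M := le_max_left _ _
  have hM0 : 0 < M := zero_lt_one.trans_le hM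
  refine ⟨M, hM0, ?_⟩
  have h2 := h.phi_mul_le (inv_nonneg.2 hM0.le) (inv_le_one_of_one_le₀ hM) hM0.le
  rw [inv_mul_cancel₀ hM0.ne', inv_mul_eq_div, le_div_iff₀ hM0] at h2
  have h3 : C ≤ M * φ 1 := (div_le_iff₀ h1).1 (le_max_right _ _)
  linarith

lemma exists_le_phi_div (h : CCFactorization θ φ ψ) (C : ℝ) {ε : ℝ} (hε : 0 < ε) :
    ∃ T, 0 < T ∧ C ≤ φ (ψ ε / T) := by
  obtain ⟨M, hM, hC⟩ := h.exists_le_phi C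
  have hψ : 0 < ψ ε := by
    simpa [h.psi_zero] using h.psi_strictMono (mem_Ici.2 le_rfl) (mem_Ici.2 hε.le) hε
  exact ⟨ψ ε / M, div_pos hψ hM, by rwa [div_div_cancel₀ hψ.ne']⟩

lemma continuous_modular (h : CCFactorization θ φ ψ) {T : ℝ} (hT : 0 < T) :
    Continuous fun u : ℝ => ENNReal.ofReal (φ (ψ |u| / T)) := by
  have hψ : Continuous fun u : ℝ => ψ |u| :=
    h.psi_continuous.comp_continuous continuous_abs abs_nonneg
  exact ENNReal.continuous_ofReal.comp <| h.phi_continuous.comp_continuous (hψ.div_const T)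
    fun u => div_nonneg (h.psi_nonneg (abs_nonneg u)) hT.le

lemma modular_anti (h : CCFactorization θ φ ψ) {t T : ℝ} (ht : 0 < t) (htT : t ≤ T) (u : ℝ) :
    ENNReal.ofReal (φ (ψ |u| / T)) ≤ ENNReal.ofReal (φ (ψ |u| / t)) := by
  have hu := h.psi_nonneg (abs_nonneg u)
  exact ENNReal.ofReal_le_ofReal <|
    h.phi_mono (div_nonneg hu (ht.trans_le htT).le) (div_le_div_of_nonneg_left hu ht htT)

lemma modular_add_le (h : CCFactorization θ φ ψ) {T : ℝ} (hT : 0 < T) (u v : ℝ) :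
    ENNReal.ofReal (φ (ψ |u + v| / (2 * T))) ≤
      ENNReal.ofReal (φ (ψ |u| / T)) + ENNReal.ofReal (φ (ψ |v| / T)) := by
  have hu := div_nonneg (h.psi_nonneg (abs_nonneg u)) hT.le
  have hv := div_nonneg (h.psi_nonneg (abs_nonneg v)) hT.le
  rw [← ENNReal.ofReal_add (h.phi_nonneg hu) (h.phi_nonneg hv)]
  refine ENNReal.ofReal_le_ofReal ?_
  have h1 : ψ |u + v| ≤ ψ |u| + ψ |v| :=
    (h.psi_mono (abs_nonneg _) (abs_add_le u v)).trans
      (h.psi_add_le (abs_nonneg u) (abs_nonneg v))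
  have h2 : ψ |u + v| / (2 * T) ≤ 1 / 2 * (ψ |u| / T) + 1 / 2 * (ψ |v| / T) := by
    calc ψ |u + v| / (2 * T) ≤ (ψ |u| + ψ |v|) / (2 * T) := by gcongr
      _ = _ := by field_simp
  have h3 := h.phi_convex.2 (mem_Ici.2 hu) (mem_Ici.2 hv) (one_half_pos (α := ℝ)).le
    (one_half_pos (α := ℝ)).le (add_halves 1)
  simp only [smul_eq_mul] at h3
  have h4 := h.phi_mono (div_nonneg (h.psi_nonneg (abs_nonneg _)) (by positivity)) h2
  linarith [h.phi_nonneg hu, h.phi_nonneg hv]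

variable {X : Type*} [MeasurableSpace X] {μ : Measure X}

lemma lintegral_le_one_of_dTheta_lt (h : CCFactorization θ φ ψ) {f g : X → ℝ} {T : ℝ}
    (hd : dTheta μ φ ψ f g < ENNReal.ofReal T) :
    ∫⁻ x, ENNReal.ofReal (φ (ψ |f x - g x| / T)) ∂μ ≤ 1 := by
  obtain ⟨t, ⟨ht0, ht, hint⟩, htT⟩ := sInf_lt_iff.1 hd
  refine le_trans (lintegral_mono fun x => ?_) hint
  exact h.modular_anti (ENNReal.toReal_pos ht0.ne' ht)
    ((ENNReal.lt_ofReal_iff_toReal_lt ht).1 htT).le _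

lemma measure_le_of_lintegral_le_one (h : CCFactorization θ φ ψ) {g : X → ℝ} (hg : Measurable g)
    {C ε T : ℝ} (hC : 0 < C) (hε : 0 ≤ ε) (hT : 0 < T) (hCT : C ≤ φ (ψ ε / T))
    (hint : ∫⁻ x, ENNReal.ofReal (φ (ψ |g x| / T)) ∂μ ≤ 1) :
    μ {x | ε ≤ |g x|} ≤ (ENNReal.ofReal C)⁻¹ := by
  calc μ {x | ε ≤ |g x|}
      ≤ μ {x | ENNReal.ofReal C ≤ ENNReal.ofReal (φ (ψ |g x| / T))} := by
        refine measure_mono fun x (hx : ε ≤ |g x|) => ENNReal.ofReal_le_ofReal (hCT.trans ?_)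
        exact h.phi_mono (div_nonneg (h.psi_nonneg hε) hT.le)
          (div_le_div_of_nonneg_right (h.psi_mono hε hx) hT.le)
    _ ≤ (∫⁻ x, ENNReal.ofReal (φ (ψ |g x| / T)) ∂μ) / ENNReal.ofReal C :=
        meas_ge_le_lintegral_div ((h.continuous_modular hT).measurable.comp hg).aemeasurable
          (ENNReal.ofReal_pos.2 hC).ne' ENNReal.ofReal_ne_top
    _ ≤ (ENNReal.ofReal C)⁻¹ := by
        rw [← one_div]
        exact ENNReal.div_le_div_right hint _

lemma exists_tendsto_ae_subseq (h : CCFactorization θ φ ψ) {fs : ℕ → X → ℝ}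
    (hmeas : ∀ n, Measurable (fs n))
    (hcauchy : ∀ ε : ℝ≥0∞, 0 < ε → ∃ N : ℕ, ∀ m ≥ N, ∀ n ≥ N,
      dTheta μ φ ψ (fs m) (fs n) < ε) :
    ∃ (f : X → ℝ) (ns : ℕ → ℕ), Measurable f ∧ StrictMono ns ∧
      ∀ᵐ x ∂μ, Tendsto (fun k => fs (ns k) x) atTop (𝓝 (f x)) := by
  choose T hT hTφ using fun k : ℕ =>
    h.exists_le_phi_div (2 ^ k) (ε := (1 / 2) ^ k) (by positivity)
  obtain ⟨ns, hns, hd⟩ := extraction_forall_of_eventually'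
    (P := fun k m => ∀ n ≥ m, dTheta μ φ ψ (fs m) (fs n) < ENNReal.ofReal (T k)) fun k => by
      obtain ⟨N, hN⟩ := hcauchy _ (ENNReal.ofReal_pos.2 (hT k))
      exact ⟨N, fun m hm n hn => hN m hm n (hm.trans hn)⟩
  have hμ : ∀ k, μ {x | (1 / 2 : ℝ) ^ k ≤ |fs (ns k) x - fs (ns (k + 1)) x|} ≤ 2⁻¹ ^ k := by
    intro k
    have := h.measure_le_of_lintegral_le_one ((hmeas (ns k)).sub (hmeas (ns (k + 1))))
      (by positivity) (by positivity) (hT k) (hTφ k)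
      (h.lintegral_le_one_of_dTheta_lt (hd k _ (hns k.lt_succ_self).le))
    rwa [ENNReal.ofReal_pow zero_le_two, ENNReal.ofReal_ofNat, ENNReal.inv_pow] at this
  have hsum : ∑' k, μ {x | (1 / 2 : ℝ) ^ k ≤ |fs (ns k) x - fs (ns (k + 1)) x|} ≠ ∞ := by
    refine ne_top_of_le_ne_top ?_ (ENNReal.tsum_le_tsum hμ)
    rw [ENNReal.tsum_geometric, ENNReal.one_sub_inv_two, inv_inv]
    exact ENNReal.ofNat_ne_top
  obtain ⟨f, hf, hlim⟩ := measurable_limit_of_tendsto_metrizable_ae (μ := μ) (L := atTop)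
    (fun k => (hmeas (ns k)).aemeasurable) <| by
      filter_upwards [ae_eventually_notMem hsum] with x hx
      refine cauchySeq_tendsto_of_complete (cauchySeq_of_summable_dist ?_)
      refine summable_geometric_two.of_norm_bounded_eventually_nat ?_
      filter_upwards [hx] with k hk
      rw [Real.norm_of_nonneg dist_nonneg, Real.dist_eq]
      exact (not_le.1 hk).le
  exact ⟨f, ns, hf, hns, hlim⟩

lemma lintegral_le_of_tendsto_ae (h : CCFactorization θ φ ψ) {gs : ℕ → X → ℝ} {g : X → ℝ}
    (hmeas : ∀ k, Measurable (gs k))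
    (hlim : ∀ᵐ x ∂μ, Tendsto (fun k => gs k x) atTop (𝓝 (g x))) {T : ℝ} (hT : 0 < T)
    {C : ℝ≥0∞}
    (hC : ∀ᶠ k in atTop, ∫⁻ x, ENNReal.ofReal (φ (ψ |gs k x| / T)) ∂μ ≤ C) :
    ∫⁻ x, ENNReal.ofReal (φ (ψ |g x| / T)) ∂μ ≤ C := by
  have hcont := h.continuous_modular hT
  calc ∫⁻ x, ENNReal.ofReal (φ (ψ |g x| / T)) ∂μ
      = ∫⁻ x, liminf (fun k => ENNReal.ofReal (φ (ψ |gs k x| / T))) atTop ∂μ := by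
        refine lintegral_congr_ae ?_
        filter_upwards [hlim] with x hx
        exact ((hcont.tendsto _).comp hx).liminf_eq.symm
    _ ≤ liminf (fun k => ∫⁻ x, ENNReal.ofReal (φ (ψ |gs k x| / T)) ∂μ) atTop :=
        lintegral_liminf_le fun k => hcont.measurable.comp (hmeas k)
    _ ≤ C := liminf_le_of_frequently_le' hC.frequently

lemma memLTheta_of_sub (h : CCFactorization θ φ ψ) {f g : X → ℝ} (hf : Measurable f)
    (hfm : MemLTheta μ φ ψ f) {T : ℝ} (hT : 0 < T)
    (hfg : ∫⁻ x, ENNReal.ofReal (φ (ψ |f x - g x| / T)) ∂μ < ⊤) : MemLTheta μ φ ψ g := by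
  obtain ⟨t, ht, hft⟩ := hfm
  have hS : 0 < max t T := lt_max_of_lt_left ht
  refine ⟨2 * max t T, by positivity, ?_⟩
  calc ∫⁻ x, ENNReal.ofReal (φ (ψ |g x| / (2 * max t T))) ∂μ
      ≤ ∫⁻ x, (ENNReal.ofReal (φ (ψ |f x| / t)) +
          ENNReal.ofReal (φ (ψ |f x - g x| / T))) ∂μ := by
        refine lintegral_mono fun x => ?_
        have h1 := h.modular_add_le hS (f x) (-(f x - g x))
        rw [abs_neg, ← sub_eq_add_neg, sub_sub_cancel] at h1
        exact h1.trans (add_le_add (h.modular_anti ht (le_max_left _ _) _)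
          (h.modular_anti hT (le_max_right _ _) _))
    _ = ∫⁻ x, ENNReal.ofReal (φ (ψ |f x| / t)) ∂μ +
          ∫⁻ x, ENNReal.ofReal (φ (ψ |f x - g x| / T)) ∂μ :=
        lintegral_add_left ((h.continuous_modular ht).measurable.comp hf) _
    _ < ⊤ := ENNReal.add_lt_top.2 ⟨hft, hfg⟩

end CCFactorization

lemma dTheta_le_of_lintegral_le_one {X : Type*} [MeasurableSpace X] {μ : Measure X}
    {φ ψ : ℝ → ℝ} {f g : X → ℝ} {T : ℝ} (hT : 0 < T)
    (hint : ∫⁻ x, ENNReal.ofReal (φ (ψ |f x - g x| / T)) ∂μ ≤ 1) :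
    dTheta μ φ ψ f g ≤ ENNReal.ofReal T :=
  sInf_le ⟨ENNReal.ofReal_pos.2 hT, ENNReal.ofReal_ne_top, by rwa [ENNReal.toReal_ofReal hT.le]⟩

/-- Completeness of `L^θ(X,μ)`: every `d_θ`-Cauchy sequence of measurable functions in
`L^θ(X,μ)` converges in `d_θ` to some measurable function in `L^θ(X,μ)`. -/
theorem LTheta_complete
    {X : Type*} [MeasurableSpace X] (μ : Measure X) [SigmaFinite μ]
    (θ φ ψ : ℝ → ℝ) (hfact : CCFactorization θ φ ψ)
    (fs : ℕ → X → ℝ) (hmeas : ∀ n, Measurable (fs n)) (hmem : ∀ n, MemLTheta μ φ ψ (fs n))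
    (hcauchy : ∀ ε : ℝ≥0∞, 0 < ε → ∃ N : ℕ, ∀ m ≥ N, ∀ n ≥ N,
      dTheta μ φ ψ (fs m) (fs n) < ε) :
    ∃ f : X → ℝ, Measurable f ∧ MemLTheta μ φ ψ f ∧
      Tendsto (fun n => dTheta μ φ ψ (fs n) f) atTop (𝓝 0) := by
  obtain ⟨f, ns, hf, hns, hlim⟩ := hfact.exists_tendsto_ae_subseq hmeas hcauchy
  have key : ∀ T : ℝ, 0 < T → ∃ N, ∀ n ≥ N,
      ∫⁻ x, ENNReal.ofReal (φ (ψ |fs n x - f x| / T)) ∂μ ≤ 1 := by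
    intro T hT
    obtain ⟨N, hN⟩ := hcauchy _ (ENNReal.ofReal_pos.2 hT)
    refine ⟨N, fun n hn => hfact.lintegral_le_of_tendsto_ae
      (gs := fun k x => fs n x - fs (ns k) x) (fun k => (hmeas n).sub (hmeas (ns k))) ?_ hT ?_⟩
    · filter_upwards [hlim] with x hx using hx.const_sub _
    · filter_upwards [hns.tendsto_atTop.eventually_ge_atTop N] with k hk
      exact hfact.lintegral_le_one_of_dTheta_lt (hN n hn _ hk)
  refine ⟨f, hf, ?_, ?_⟩
  · obtain ⟨N, hN⟩ := key 1 one_pos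
    exact hfact.memLTheta_of_sub (hmeas N) (hmem N) one_pos
      ((hN N le_rfl).trans_lt ENNReal.one_lt_top)
  · refine ENNReal.tendsto_atTop_zero.2 fun ε hε => ?_
    obtain ⟨r, hr0, hr⟩ := ENNReal.lt_iff_exists_nnreal_btwn.1 hε
    have hr0' : 0 < (r : ℝ) := NNReal.coe_pos.2 (ENNReal.coe_pos.1 hr0)
    obtain ⟨N, hN⟩ := key r hr0'
    refine ⟨N, fun n hn => (dTheta_le_of_lintegral_le_one hr0' (hN n hn)).trans ?_⟩
    rw [ENNReal.ofReal_coe_nnreal]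
    exact hr.le
end

section
/- Let (X, Ξ, μ) be a measure space with μ(X) = 1, let (φ, ψ) be a convex-concave factorization of a ccc function θ, and let Φ: ℝ₊ → ℝ₊ be strictly increasing, convex and continuous with Φ(1) = 1 (equivalently Φ⁻¹(1) = 1). Then, with (Φ∘φ, ψ) as factorization of Φ∘θ, for all measurable f, g: X → ℝ one has d_{Φ∘θ}(f, g) ≥ d_θ(f, g) (Jensen's inequality for the metrics d_θ). -/
open Set Function MeasureTheory
open scoped ENNReal

/-- A convex function on a set of reals has a supporting line at every interior point. -/
theorem ConvexOn.exists_supporting_line {S : Set ℝ} {f : ℝ → ℝ} {x : ℝ}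
    (hf : ConvexOn ℝ S f) (hx : x ∈ interior S) :
    ∃ c : ℝ, ∀ y ∈ S, f x + c * (y - x) ≤ f y := by
  refine ⟨derivWithin f (Set.Ioi x) x, fun y hy => ?_⟩
  rcases lt_trichotomy x y with hxy | rfl | hxy
  · have h := hf.rightDeriv_le_slope_of_mem_interior hx hy hxy
    rw [slope_def_field, le_div_iff₀ (sub_pos.2 hxy)] at h
    linarith
  · simp
  · have h := (hf.slope_le_leftDeriv_of_mem_interior hy hx hxy).trans
      (hf.leftDeriv_le_rightDeriv_of_mem_interior hx)
    rw [slope_def_field, div_le_iff₀ (sub_pos.2 hxy)] at h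
    linarith

/-- If `1 + c * (h - 1) ≤ H` pointwise with `c > 0` and `H` has integral at most `1` on a
probability space, then so has `h`. -/
theorem lintegral_ofReal_le_one_of_supporting_line {X : Type*} [MeasurableSpace X]
    {μ : Measure X} [IsProbabilityMeasure μ] {h H : X → ℝ} {c : ℝ} (hc : 0 < c)
    (h_nonneg : ∀ x, 0 ≤ h x) (H_nonneg : ∀ x, 0 ≤ H x) (hH : ∀ x, 1 + c * (h x - 1) ≤ H x)
    (hint : ∫⁻ x, ENNReal.ofReal (H x) ∂μ ≤ 1) :
    ∫⁻ x, ENNReal.ofReal (h x) ∂μ ≤ 1 := by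
  have hpt (x : X) : ENNReal.ofReal c * ENNReal.ofReal (h x) + 1
      ≤ ENNReal.ofReal (H x) + ENNReal.ofReal c := by
    rw [← ENNReal.ofReal_mul hc.le, ← ENNReal.ofReal_one,
      ← ENNReal.ofReal_add (mul_nonneg hc.le (h_nonneg x)) zero_le_one,
      ← ENNReal.ofReal_add (H_nonneg x) hc.le]
    exact ENNReal.ofReal_le_ofReal (by linarith [hH x])
  have key := lintegral_mono (μ := μ) hpt
  rw [lintegral_add_right _ measurable_const, lintegral_add_right _ measurable_const,
    lintegral_const_mul' _ _ ENNReal.ofReal_ne_top] at key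
  simp only [lintegral_const, measure_univ, mul_one] at key
  have hle := key.trans (add_le_add_left hint (ENNReal.ofReal c))
  rw [add_comm 1, ENNReal.add_le_add_iff_right ENNReal.one_ne_top] at hle
  exact (ENNReal.mul_le_mul_iff_right (ENNReal.ofReal_pos.2 hc).ne' ENNReal.ofReal_ne_top).1
    (by rwa [mul_one])

/-- "Jensen's inequality": on a probability space, for a strictly increasing convex continuous
`Φ : ℝ₊ → ℝ₊` with `Φ(1) = 1`, composing the convex part of the factorization with `Φ` enlarges
the distance: `d_{Φ∘θ}(f,g) ≥ d_θ(f,g)`, where `Φ∘θ` carries the factorization `(Φ∘φ, ψ)`. -/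
theorem dTheta_le_dTheta_comp
    {X : Type*} [MeasurableSpace X] (μ : Measure X) [IsProbabilityMeasure μ]
    (θ φ ψ : ℝ → ℝ) (hfact : CCFactorization θ φ ψ)
    (Φ : ℝ → ℝ)
    (hΦ_mono : StrictMonoOn Φ (Set.Ici 0))
    (hΦ_cont : ContinuousOn Φ (Set.Ici 0))
    (hΦ_convex : ConvexOn ℝ (Set.Ici 0) Φ)
    (hΦ_maps : Set.MapsTo Φ (Set.Ici 0) (Set.Ici 0))
    (hΦ_one : Φ 1 = 1)
    (f g : X → ℝ) (hf : Measurable f) (hg : Measurable g) :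
    dTheta μ φ ψ f g ≤ dTheta μ (fun x => Φ (φ x)) ψ f g := by
  obtain ⟨c, hline⟩ := hΦ_convex.exists_supporting_line (x := 1) (by simp)
  rw [hΦ_one] at hline
  have hc : 0 < c := by
    have h₀ := hline 0 (by simp)
    have h₁ : Φ 0 < Φ 1 := hΦ_mono (by simp) (by simp) one_pos
    linarith
  refine sInf_le_sInf fun t ht => ⟨ht.1, ht.2.1, ?_⟩
  have hφ (x : X) : φ (ψ |f x - g x| / t.toReal) ∈ Set.Ici (0 : ℝ) :=
    hfact.phi_mapsTo (div_nonneg (hfact.psi_mapsTo (Set.mem_Ici.2 (abs_nonneg _))) ENNReal.toReal_nonneg)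
  exact lintegral_ofReal_le_one_of_supporting_line hc hφ (fun x => hΦ_maps (hφ x))
    (fun x => hline _ (hφ x)) ht.2.2
end

section
/- Let (X, d) be a complete separable metric space and (φ, ψ) a convex-concave factorization of a ccc function θ. Then for every pair of probability measures μ, ν ∈ P_θ(X) with w := W_θ(μ, ν) ∈ (0, ∞), there exists an optimal coupling, i.e. a coupling q ∈ Π(μ, ν) with ∫_{X×X} φ( ψ(d(x,y))/w ) dq(x,y) ≤ 1. -/
open Set Function MeasureTheory Filter
open scoped ENNReal Topology

/-- The set `Π(μ,ν)` of couplings of `μ` and `ν`: probability measures on `X × X` whose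
marginals are `μ` and `ν`. -/
def Couplings {X : Type*} [MeasurableSpace X] (μ ν : MeasureTheory.Measure X) :
    Set (MeasureTheory.Measure (X × X)) :=
  {q | MeasureTheory.IsProbabilityMeasure q ∧
    q.map Prod.fst = μ ∧ q.map Prod.snd = ν}

/-- The `L^θ`-Wasserstein distance
`W_θ(μ,ν) = inf { t > 0 : inf_{q ∈ Π(μ,ν)} ∫ φ(ψ(d(x,y))/t) dq ≤ 1 }`
(with value `∞` if no such `t` exists). -/
noncomputable def WTheta {X : Type*} [MetricSpace X] [MeasurableSpace X]
    (φ ψ : ℝ → ℝ) (μ ν : MeasureTheory.Measure X) : ℝ≥0∞ :=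
  sInf {t : ℝ≥0∞ | 0 < t ∧ t ≠ ⊤ ∧
    (⨅ q ∈ Couplings μ ν,
      ∫⁻ p, ENNReal.ofReal (φ (ψ (dist p.1 p.2) / t.toReal)) ∂q) ≤ 1}

/-- Membership in the `L^θ`-Wasserstein space `P_θ(X)`: a Borel probability measure `μ` with
`∫ φ(ψ(d(x,y))/t) dμ(x) < ∞` for some `y ∈ X` and some `t ∈ (0,∞)`. -/
def MemPTheta {X : Type*} [MetricSpace X] [MeasurableSpace X]
    (φ ψ : ℝ → ℝ) (μ : MeasureTheory.Measure X) : Prop :=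
  MeasureTheory.IsProbabilityMeasure μ ∧
    ∃ y : X, ∃ t : ℝ, 0 < t ∧
      ∫⁻ x, ENNReal.ofReal (φ (ψ (dist x y) / t)) ∂μ < ⊤

section Couplings

variable {X : Type*} [MetricSpace X] [CompleteSpace X] [TopologicalSpace.SeparableSpace X]
  [MeasurableSpace X] [BorelSpace X]

/-- The set of couplings of two probability measures is tight. -/
lemma isTightMeasureSet_couplings (μ ν : Measure X) [IsProbabilityMeasure μ]
    [IsProbabilityMeasure ν] : IsTightMeasureSet (Couplings μ ν) := by
  have := UniformSpace.secondCountable_of_separable X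
  refine IsTightMeasureSet.prodMk
    ((isTightMeasureSet_singleton (μ := μ)).subset ?_)
    ((isTightMeasureSet_singleton (μ := ν)).subset ?_)
  · rintro _ ⟨q, hq, rfl⟩
    exact hq.2.1
  · rintro _ ⟨q, hq, rfl⟩
    exact hq.2.2

/-- The set of couplings of two probability measures is closed in the weak topology. -/
lemma isClosed_couplings (μ ν : Measure X) [hμ : IsProbabilityMeasure μ]
    [hν : IsProbabilityMeasure ν] :
    IsClosed {q : ProbabilityMeasure (X × X) | (q : Measure (X × X)) ∈ Couplings μ ν} := by
  have := UniformSpace.secondCountable_of_separable X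
  obtain ⟨μ, rfl⟩ : ∃ μ' : ProbabilityMeasure X, (μ' : Measure X) = μ := ⟨⟨μ, hμ⟩, rfl⟩
  obtain ⟨ν, rfl⟩ : ∃ ν' : ProbabilityMeasure X, (ν' : Measure X) = ν := ⟨⟨ν, hν⟩, rfl⟩
  have key : {q : ProbabilityMeasure (X × X) | (q : Measure (X × X)) ∈ Couplings ↑μ ↑ν} =
      {q | q.map (continuous_fst (X := X) (Y := X)).measurable.aemeasurable = μ} ∩
      {q | q.map (continuous_snd (X := X) (Y := X)).measurable.aemeasurable = ν} := by
    ext q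
    exact ⟨fun h ↦ ⟨Subtype.ext h.2.1, Subtype.ext h.2.2⟩,
      fun h ↦ ⟨q.2, congrArg Subtype.val h.1, congrArg Subtype.val h.2⟩⟩
  rw [key]
  exact (isClosed_eq (ProbabilityMeasure.continuous_map continuous_fst) continuous_const).inter
    (isClosed_eq (ProbabilityMeasure.continuous_map continuous_snd) continuous_const)

/-- The set of couplings of two probability measures is compact in the weak topology. -/
lemma isCompact_couplings (μ ν : Measure X) [IsProbabilityMeasure μ]
    [IsProbabilityMeasure ν] :
    IsCompact {q : ProbabilityMeasure (X × X) | (q : Measure (X × X)) ∈ Couplings μ ν} := by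
  have := UniformSpace.secondCountable_of_separable X
  rw [← (isClosed_couplings μ ν).closure_eq]
  refine isCompact_closure_of_isTightMeasureSet ((isTightMeasureSet_couplings μ ν).subset ?_)
  rintro _ ⟨q, hq, rfl⟩
  exact hq

end Couplings

/-- The integral of a nonnegative continuous function is sequentially lower semicontinuous with
respect to weak convergence of probability measures. -/
lemma lintegral_le_liminf_of_tendsto_probabilityMeasure {Ω : Type*} [MeasurableSpace Ω]
    [TopologicalSpace Ω] [OpensMeasurableSpace Ω] [HasOuterApproxClosed Ω]
    {μ : ProbabilityMeasure Ω} {μs : ℕ → ProbabilityMeasure Ω}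
    (h : Tendsto μs atTop (𝓝 μ)) {f : Ω → ℝ} (hf : Continuous f) (hf0 : 0 ≤ f) :
    ∫⁻ x, ENNReal.ofReal (f x) ∂(μ : Measure Ω) ≤
      liminf (fun n ↦ ∫⁻ x, ENNReal.ofReal (f x) ∂(μs n : Measure Ω)) atTop :=
  lintegral_le_liminf_lintegral_of_forall_isOpen_measure_le_liminf_measure hf hf0
    fun _ hG ↦ ProbabilityMeasure.le_liminf_measure_open_of_tendsto h hG

namespace CCFactorization

variable {θ φ ψ : ℝ → ℝ}

lemma psi_div_nonneg (h : CCFactorization θ φ ψ) {r t : ℝ} (hr : 0 ≤ r) (ht : 0 ≤ t) :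
    0 ≤ ψ r / t :=
  div_nonneg (h.psi_mapsTo hr) ht

lemma cost_nonneg (h : CCFactorization θ φ ψ) {r t : ℝ} (hr : 0 ≤ r) (ht : 0 ≤ t) :
    0 ≤ φ (ψ r / t) :=
  h.phi_mapsTo (h.psi_div_nonneg hr ht)

lemma cost_antitone (h : CCFactorization θ φ ψ) {r s t : ℝ} (hr : 0 ≤ r) (hs : 0 < s)
    (hst : s ≤ t) : φ (ψ r / t) ≤ φ (ψ r / s) :=
  h.phi_strictMono.monotoneOn (h.psi_div_nonneg hr (hs.le.trans hst)) (h.psi_div_nonneg hr hs.le)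
    (div_le_div_of_nonneg_left (h.psi_mapsTo hr) hs hst)

lemma continuous_cost_dist (h : CCFactorization θ φ ψ) {X : Type*} [MetricSpace X] {t : ℝ}
    (ht : 0 ≤ t) : Continuous fun p : X × X ↦ φ (ψ (dist p.1 p.2) / t) :=
  h.phi_continuous.comp_continuous
    ((h.psi_continuous.comp_continuous continuous_dist fun _ ↦ dist_nonneg).div_const t)
    fun _ ↦ h.psi_div_nonneg dist_nonneg ht

lemma tendsto_cost (h : CCFactorization θ φ ψ) {r w : ℝ} (hr : 0 ≤ r) (hw : 0 < w)
    {t : ℕ → ℝ} (ht0 : ∀ n, 0 < t n) (ht : Tendsto t atTop (𝓝 w)) :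
    Tendsto (fun n ↦ φ (ψ r / t n)) atTop (𝓝 (φ (ψ r / w))) := by
  refine (h.phi_continuous _ (h.psi_div_nonneg hr hw.le)).tendsto.comp
    (tendsto_nhdsWithin_iff.2 ⟨tendsto_const_nhds.div ht hw.ne', ?_⟩)
  exact Eventually.of_forall fun n ↦ h.psi_div_nonneg hr (ht0 n).le

end CCFactorization

/-- Strictly above the Wasserstein distance there are couplings with cost almost at most `1`. -/
lemma exists_coupling_lintegral_lt {X : Type*} [MetricSpace X] [MeasurableSpace X]
    {θ φ ψ : ℝ → ℝ} (hfact : CCFactorization θ φ ψ) {μ ν : Measure X}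
    (hw_fin : WTheta φ ψ μ ν ≠ ⊤) {t : ℝ} (ht : (WTheta φ ψ μ ν).toReal < t)
    {a : ℝ≥0∞} (ha : 1 < a) :
    ∃ q ∈ Couplings μ ν, ∫⁻ p, ENNReal.ofReal (φ (ψ (dist p.1 p.2) / t)) ∂q < a := by
  have ht' : WTheta φ ψ μ ν < ENNReal.ofReal t :=
    (ENNReal.lt_ofReal_iff_toReal_lt hw_fin).2 ht
  obtain ⟨s, ⟨hs0, hs_top, hs⟩, hst⟩ := sInf_lt_iff.1 ht'
  obtain ⟨q, hq⟩ := iInf_lt_iff.1 (hs.trans_lt ha)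
  obtain ⟨hqc, hqa⟩ := iInf_lt_iff.1 hq
  refine ⟨q, hqc, lt_of_le_of_lt (lintegral_mono fun p ↦ ENNReal.ofReal_le_ofReal ?_) hqa⟩
  exact hfact.cost_antitone dist_nonneg (ENNReal.toReal_pos hs0.ne' hs_top)
    ((ENNReal.lt_ofReal_iff_toReal_lt hs_top).1 hst).le

/-- Existence of optimal couplings: if `μ, ν ∈ P_θ(X)` and `w := W_θ(μ,ν) ∈ (0,∞)`, then there
exists a coupling `q ∈ Π(μ,ν)` with `∫ φ(ψ(d(x,y))/w) dq ≤ 1`. -/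
theorem exists_optimal_coupling
    {X : Type*} [MetricSpace X] [CompleteSpace X] [TopologicalSpace.SeparableSpace X]
    [MeasurableSpace X] [BorelSpace X]
    (θ φ ψ : ℝ → ℝ) (hfact : CCFactorization θ φ ψ)
    (μ ν : Measure X) (hμ : MemPTheta φ ψ μ) (hν : MemPTheta φ ψ ν)
    (hw_pos : 0 < WTheta φ ψ μ ν) (hw_fin : WTheta φ ψ μ ν ≠ ⊤) :
    ∃ q ∈ Couplings μ ν,
      ∫⁻ p, ENNReal.ofReal (φ (ψ (dist p.1 p.2) / (WTheta φ ψ μ ν).toReal)) ∂q ≤ 1 := by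
  have := hμ.1
  have := hν.1
  have := UniformSpace.secondCountable_of_separable X
  set w := (WTheta φ ψ μ ν).toReal
  have hw0 : 0 < w := ENNReal.toReal_pos hw_pos.ne' hw_fin
  obtain ⟨t, ht_anti, htw, ht_lim⟩ := exists_seq_strictAnti_tendsto w
  obtain ⟨a, -, ha1, ha_lim⟩ := exists_seq_strictAnti_tendsto' (ENNReal.one_lt_top)
  have hq : ∀ n, ∃ q : ProbabilityMeasure (X × X), (q : Measure (X × X)) ∈ Couplings μ ν ∧
      ∫⁻ p, ENNReal.ofReal (φ (ψ (dist p.1 p.2) / t n)) ∂(q : Measure (X × X)) < a n := by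
    intro n
    obtain ⟨q, hqc, hqa⟩ := exists_coupling_lintegral_lt hfact hw_fin (htw n) (ha1 n).1
    exact ⟨⟨q, hqc.1⟩, hqc, hqa⟩
  choose q hqc hqa using hq
  obtain ⟨q₀, hq₀, k, hk, hlim⟩ := (isCompact_couplings μ ν).tendsto_subseq hqc
  have ht0 : ∀ n, 0 < t n := fun n ↦ hw0.trans (htw n)
  have hcost : ∀ m,
      ∫⁻ p, ENNReal.ofReal (φ (ψ (dist p.1 p.2) / t m)) ∂(q₀ : Measure (X × X)) ≤ 1 := by
    intro m
    refine (lintegral_le_liminf_of_tendsto_probabilityMeasure hlim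
      (hfact.continuous_cost_dist (ht0 m).le)
      fun p ↦ hfact.cost_nonneg dist_nonneg (ht0 m).le).trans ?_
    rw [← (ha_lim.comp hk.tendsto_atTop).liminf_eq]
    refine liminf_le_liminf ?_
    filter_upwards [eventually_ge_atTop m] with n hn
    refine le_trans (lintegral_mono fun p ↦ ENNReal.ofReal_le_ofReal ?_) (hqa (k n)).le
    exact hfact.cost_antitone dist_nonneg (ht0 _) (ht_anti.antitone (hn.trans (hk.id_le n)))
  refine ⟨q₀, hq₀, ?_⟩
  calc ∫⁻ p, ENNReal.ofReal (φ (ψ (dist p.1 p.2) / w)) ∂(q₀ : Measure (X × X))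
      = ∫⁻ p, liminf (fun m ↦ ENNReal.ofReal (φ (ψ (dist p.1 p.2) / t m))) atTop
          ∂(q₀ : Measure (X × X)) := by
        refine lintegral_congr fun p ↦ Tendsto.liminf_eq ?_ |>.symm
        exact ENNReal.tendsto_ofReal (hfact.tendsto_cost dist_nonneg hw0 ht0 ht_lim)
    _ ≤ liminf (fun m ↦ ∫⁻ p, ENNReal.ofReal (φ (ψ (dist p.1 p.2) / t m))
          ∂(q₀ : Measure (X × X))) atTop :=
        lintegral_liminf_le fun m ↦
          (hfact.continuous_cost_dist (ht0 m).le).measurable.ennreal_ofReal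
    _ ≤ 1 := (liminf_le_liminf (Eventually.of_forall hcost)).trans_eq (by simp)
end

section
/- Let (X, d) be a complete separable metric space and φ, ψ: ℝ₊ → ℝ₊ strictly increasing continuous with φ(0) = ψ(0) = 0, φ convex, ψ concave. Let μ₁, μ₂, μ₃ be Borel probability measures on X, r, s ∈ (0, ∞), and suppose q₁₂ is a coupling of μ₁ and μ₂ with ∫_{X×X} φ( ψ(d(x,y))/r ) dq₁₂ ≤ 1 and q₂₃ is a coupling of μ₂ and μ₃ with ∫_{X×X} φ( ψ(d(y,z))/s ) dq₂₃ ≤ 1. Then there exists a coupling q₁₃ of μ₁ and μ₃ with ∫_{X×X} φ( ψ(d(x,z))/(r+s) ) dq₁₃ ≤ 1. -/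
open Set Function MeasureTheory
open scoped ENNReal

/-- A concave function on `[0, ∞)` that is nonnegative at `0` is subadditive. -/
theorem ConcaveOn.map_add_le_of_map_zero_nonneg {ψ : ℝ → ℝ}
    (hψ : ConcaveOn ℝ (Set.Ici 0) ψ) (h0 : 0 ≤ ψ 0) {a b : ℝ} (ha : 0 ≤ a) (hb : 0 ≤ b) :
    ψ (a + b) ≤ ψ a + ψ b := by
  rcases (add_nonneg ha hb).eq_or_lt with h | h
  · have ha0 : a = 0 := by linarith
    have hb0 : b = 0 := by linarith
    subst ha0 hb0
    simpa using h0
  · have key : ∀ u v : ℝ, 0 ≤ u → 0 ≤ v → u + v = a + b → u / (a + b) * ψ (a + b) ≤ ψ u := by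
      intro u v hu hv huv
      have hsum : u / (a + b) + v / (a + b) = 1 := by
        rw [← add_div, huv, div_self h.ne']
      have := hψ.2 (Set.mem_Ici.2 h.le) (Set.mem_Ici.2 le_rfl) (div_nonneg hu h.le)
        (div_nonneg hv h.le) hsum
      simp only [smul_eq_mul, mul_zero, add_zero, div_mul_cancel₀ u h.ne'] at this
      linarith [mul_nonneg (div_nonneg hv h.le) h0]
    have h1 := key a b ha hb rfl
    have h2 := key b a hb ha (add_comm b a)
    have h3 : a / (a + b) * ψ (a + b) + b / (a + b) * ψ (a + b) = ψ (a + b) := by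
      field_simp
    linarith

/-- Gluing lemma: two measures whose second and first marginals agree are the two consecutive
marginals of a measure on the triple product. -/
theorem MeasureTheory.Measure.exists_gluing {X Y Z : Type*} [MeasurableSpace X]
    [MeasurableSpace Y] [MeasurableSpace Z] [StandardBorelSpace Z] [Nonempty Z]
    (q : Measure (X × Y)) (q' : Measure (Y × Z)) [IsFiniteMeasure q] [IsFiniteMeasure q']
    (h : q.map Prod.snd = q'.map Prod.fst) :
    ∃ γ : Measure ((X × Y) × Z), γ.map Prod.fst = q ∧ γ.map (fun p => (p.1.2, p.2)) = q' := by
  refine ⟨q.compProd (q'.condKernel.prodMkLeft X), Measure.fst_compProd q _, ?_⟩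
  have hm : Measurable fun p : (X × Y) × Z => (p.1.2, p.2) := by fun_prop
  ext t ht
  conv_rhs => rw [← q'.disintegrate q'.condKernel]
  rw [Measure.map_apply hm ht, Measure.compProd_apply (hm ht), Measure.compProd_apply ht,
    Measure.fst, ← h, lintegral_map (ProbabilityTheory.Kernel.measurable_kernel_prodMk_left ht)
      measurable_snd]
  rfl

/-- Gluing estimate: from couplings `q₁₂` of `(μ₁,μ₂)` and `q₂₃` of `(μ₂,μ₃)` with
`∫ φ(ψ(d)/r) dq₁₂ ≤ 1` and `∫ φ(ψ(d)/s) dq₂₃ ≤ 1`, one obtains a coupling `q₁₃` of `(μ₁,μ₃)`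
with `∫ φ(ψ(d)/(r+s)) dq₁₃ ≤ 1`. -/
theorem exists_coupling_triangle_estimate
    {X : Type*} [MetricSpace X] [CompleteSpace X] [TopologicalSpace.SeparableSpace X]
    [MeasurableSpace X] [BorelSpace X]
    (φ ψ : ℝ → ℝ)
    (hφ_mono : StrictMonoOn φ (Set.Ici 0))
    (hφ_cont : ContinuousOn φ (Set.Ici 0))
    (hφ_zero : φ 0 = 0)
    (hφ_maps : Set.MapsTo φ (Set.Ici 0) (Set.Ici 0))
    (hφ_convex : ConvexOn ℝ (Set.Ici 0) φ)
    (hψ_mono : StrictMonoOn ψ (Set.Ici 0))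
    (hψ_cont : ContinuousOn ψ (Set.Ici 0))
    (hψ_zero : ψ 0 = 0)
    (hψ_maps : Set.MapsTo ψ (Set.Ici 0) (Set.Ici 0))
    (hψ_concave : ConcaveOn ℝ (Set.Ici 0) ψ)
    (μ₁ μ₂ μ₃ : Measure X)
    [IsProbabilityMeasure μ₁] [IsProbabilityMeasure μ₂] [IsProbabilityMeasure μ₃]
    (r s : ℝ) (hr : 0 < r) (hs : 0 < s)
    (q₁₂ : Measure (X × X)) (hq₁₂ : q₁₂ ∈ Couplings μ₁ μ₂)
    (h₁₂ : ∫⁻ p, ENNReal.ofReal (φ (ψ (dist p.1 p.2) / r)) ∂q₁₂ ≤ 1)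
    (q₂₃ : Measure (X × X)) (hq₂₃ : q₂₃ ∈ Couplings μ₂ μ₃)
    (h₂₃ : ∫⁻ p, ENNReal.ofReal (φ (ψ (dist p.1 p.2) / s)) ∂q₂₃ ≤ 1) :
    ∃ q₁₃ ∈ Couplings μ₁ μ₃,
      ∫⁻ p, ENNReal.ofReal (φ (ψ (dist p.1 p.2) / (r + s))) ∂q₁₃ ≤ 1 := by
  obtain ⟨hp₁₂, h₁₂fst, h₁₂snd⟩ := hq₁₂
  obtain ⟨hp₂₃, h₂₃fst, h₂₃snd⟩ := hq₂₃
  have : Nonempty X := nonempty_of_isProbabilityMeasure μ₁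
  have : SecondCountableTopology X := UniformSpace.secondCountable_of_separable X
  obtain ⟨γ, hγ₁₂, hγ₂₃⟩ := Measure.exists_gluing q₁₂ q₂₃ (h₁₂snd.trans h₂₃fst.symm)
  have hm₂₃ : Measurable fun p : (X × X) × X => (p.1.2, p.2) := by fun_prop
  have hm₁₃ : Measurable fun p : (X × X) × X => (p.1.1, p.2) := by fun_prop
  have hψ_nonneg : ∀ x y : X, 0 ≤ ψ (dist x y) := fun x y => hψ_maps dist_nonneg
  have hmeas : ∀ c : ℝ, 0 < c →
      Measurable fun p : X × X => ENNReal.ofReal (φ (ψ (dist p.1 p.2) / c)) := by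
    intro c hc
    have hψd : Continuous fun p : X × X => ψ (dist p.1 p.2) :=
      hψ_cont.comp_continuous continuous_dist fun _ => dist_nonneg
    have hφd : Continuous fun p : X × X => φ (ψ (dist p.1 p.2) / c) :=
      hφ_cont.comp_continuous (hψd.div_const c) fun p => div_nonneg (hψ_nonneg _ _) hc.le
    exact hφd.measurable.ennreal_ofReal
  have hrs : 0 < r + s := add_pos hr hs
  have hpoint : ∀ x y z : X, φ (ψ (dist x z) / (r + s)) ≤
      r / (r + s) * φ (ψ (dist x y) / r) + s / (r + s) * φ (ψ (dist y z) / s) := by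
    intro x y z
    have hsub : ψ (dist x z) ≤ ψ (dist x y) + ψ (dist y z) :=
      (hψ_mono.monotoneOn dist_nonneg (add_nonneg dist_nonneg dist_nonneg)
        (dist_triangle x y z)).trans
        (hψ_concave.map_add_le_of_map_zero_nonneg hψ_zero.ge dist_nonneg dist_nonneg)
    calc φ (ψ (dist x z) / (r + s))
        ≤ φ ((ψ (dist x y) + ψ (dist y z)) / (r + s)) :=
          hφ_mono.monotoneOn (div_nonneg (hψ_nonneg _ _) hrs.le)
            (div_nonneg (add_nonneg (hψ_nonneg _ _) (hψ_nonneg _ _)) hrs.le) (by gcongr)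
      _ = φ (r / (r + s) * (ψ (dist x y) / r) + s / (r + s) * (ψ (dist y z) / s)) := by
          congr 1
          field_simp
      _ ≤ _ := hφ_convex.2 (div_nonneg (hψ_nonneg _ _) hr.le) (div_nonneg (hψ_nonneg _ _) hs.le)
          (by positivity) (by positivity) (by field_simp)
  refine ⟨γ.map fun p => (p.1.1, p.2), ?_, ?_⟩
  · have hfst : (γ.map fun p => (p.1.1, p.2)).map Prod.fst = μ₁ := by
      rw [Measure.map_map measurable_fst hm₁₃, ← h₁₂fst, ← hγ₁₂,
        Measure.map_map measurable_fst measurable_fst]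
      rfl
    have hsnd : (γ.map fun p => (p.1.1, p.2)).map Prod.snd = μ₃ := by
      rw [Measure.map_map measurable_snd hm₁₃, ← h₂₃snd, ← hγ₂₃,
        Measure.map_map measurable_snd hm₂₃]
      rfl
    refine ⟨?_, hfst, hsnd⟩
    have : IsProbabilityMeasure ((γ.map fun p => (p.1.1, p.2)).map Prod.fst) :=
      hfst ▸ inferInstance
    exact Measure.isProbabilityMeasure_of_map Prod.fst
  · rw [← hγ₁₂, lintegral_map (hmeas r hr) measurable_fst] at h₁₂
    rw [← hγ₂₃, lintegral_map (hmeas s hs) hm₂₃] at h₂₃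
    rw [lintegral_map (hmeas _ hrs) hm₁₃]
    calc ∫⁻ p, ENNReal.ofReal (φ (ψ (dist p.1.1 p.2) / (r + s))) ∂γ
        ≤ ∫⁻ p, (ENNReal.ofReal (r / (r + s)) * ENNReal.ofReal (φ (ψ (dist p.1.1 p.1.2) / r)) +
            ENNReal.ofReal (s / (r + s)) * ENNReal.ofReal (φ (ψ (dist p.1.2 p.2) / s))) ∂γ := by
          refine lintegral_mono fun p => ?_
          rw [← ENNReal.ofReal_mul (by positivity), ← ENNReal.ofReal_mul (by positivity)]
          exact (ENNReal.ofReal_le_ofReal (hpoint p.1.1 p.1.2 p.2)).trans ENNReal.ofReal_add_le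
      _ = ENNReal.ofReal (r / (r + s)) *
            ∫⁻ p, ENNReal.ofReal (φ (ψ (dist p.1.1 p.1.2) / r)) ∂γ +
          ENNReal.ofReal (s / (r + s)) *
            ∫⁻ p, ENNReal.ofReal (φ (ψ (dist p.1.2 p.2) / s)) ∂γ := by
          have hm₁ : Measurable fun p : (X × X) × X =>
              ENNReal.ofReal (φ (ψ (dist p.1.1 p.1.2) / r)) := (hmeas r hr).comp measurable_fst
          have hm₂ : Measurable fun p : (X × X) × X =>
              ENNReal.ofReal (φ (ψ (dist p.1.2 p.2) / s)) := (hmeas s hs).comp hm₂₃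
          rw [lintegral_add_left (hm₁.const_mul _), lintegral_const_mul _ hm₁,
            lintegral_const_mul _ hm₂]
      _ ≤ ENNReal.ofReal (r / (r + s)) * 1 + ENNReal.ofReal (s / (r + s)) * 1 := by
          gcongr
      _ = 1 := by
          rw [mul_one, mul_one, ← ENNReal.ofReal_add (by positivity) (by positivity),
            ← add_div, div_self hrs.ne', ENNReal.ofReal_one]
end

section
/- Let (X, d) be a complete separable metric space and (φ, ψ) a convex-concave factorization of a ccc function θ. Then for Borel probability measures μ, ν on X, W_θ(μ, ν) = 0 if and only if μ = ν. -/
open Set Function MeasureTheory Filter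
open scoped ENNReal Topology

section

variable {X : Type*} [MetricSpace X] [MeasurableSpace X]

theorem measurableSet_le_dist [BorelSpace X] [SecondCountableTopology X] (r : ℝ) :
    MeasurableSet {p : X × X | r ≤ dist p.1 p.2} :=
  measurableSet_le measurable_const measurable_dist

theorem ConvexOn.mul_map_one_le {φ : ℝ → ℝ} (hφ : ConvexOn ℝ (Ici 0) φ) (h0 : φ 0 = 0)
    {s : ℝ} (hs : 1 ≤ s) : s * φ 1 ≤ φ s := by
  have hs0 : 0 < s := by linarith
  have h := hφ.2 (mem_Ici.2 le_rfl) (mem_Ici.2 hs0.le)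
    (sub_nonneg.2 (inv_le_one_of_one_le₀ hs)) (inv_nonneg.2 hs0.le) (by ring)
  simp only [smul_eq_mul, mul_zero, zero_add, h0, inv_mul_cancel₀ hs0.ne'] at h
  calc s * φ 1 ≤ s * (s⁻¹ * φ s) := by gcongr
    _ = φ s := by field_simp

/-- A coupling that charges little the pairs at distance at least `ε` controls the measure of a set
by that of its thickening. -/
theorem measure_le_thickening_add_of_mem_couplings [BorelSpace X] {μ ν : Measure X}
    {q : Measure (X × X)} (hq : q ∈ Couplings μ ν) {B : Set X} (hB : MeasurableSet B) (ε : ℝ) :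
    μ B ≤ ν (Metric.thickening ε B) + q {p | ε ≤ dist p.1 p.2} := by
  obtain ⟨-, rfl, rfl⟩ := hq
  rw [Measure.map_apply measurable_fst hB,
    Measure.map_apply measurable_snd Metric.isOpen_thickening.measurableSet]
  refine (measure_mono fun p hp ↦ ?_).trans (measure_union_le _ _)
  by_cases h : ε ≤ dist p.1 p.2
  · exact Or.inr h
  · exact Or.inl (Metric.mem_thickening_iff.2 ⟨p.1, hp, by rw [dist_comm]; exact not_le.1 h⟩)

/-- If the scale `t` is small enough, the cost `φ (ψ d / t)` is at least `2 / ε` at distances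
`d ≥ ε`. -/
theorem CCFactorization.exists_forall_two_div_le {θ φ ψ : ℝ → ℝ} (h : CCFactorization θ φ ψ)
    {ε : ℝ} (hε : 0 < ε) :
    ∃ δ > 0, ∀ t, 0 < t → t < δ → ∀ d, ε ≤ d → 2 / ε ≤ φ (ψ d / t) := by
  have ha : 0 < ψ ε := by
    simpa [h.psi_zero] using h.psi_strictMono (mem_Ici.2 le_rfl) (mem_Ici.2 hε.le) hε
  have hφ1 : 0 < φ 1 := by
    simpa [h.phi_zero] using h.phi_strictMono (mem_Ici.2 le_rfl) (mem_Ici.2 zero_le_one) one_pos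
  refine ⟨min (ψ ε) (ψ ε * φ 1 * ε / 2), by positivity, fun t ht htδ d hd ↦ ?_⟩
  obtain ⟨h₁, h₂⟩ := lt_min_iff.1 htδ
  have hψ : ψ ε ≤ ψ d :=
    h.psi_strictMono.monotoneOn (mem_Ici.2 hε.le) (mem_Ici.2 (hε.le.trans hd)) hd
  have hs : 1 ≤ ψ d / t := by rw [le_div_iff₀ ht]; linarith
  refine le_trans ?_ (h.phi_convex.mul_map_one_le h.phi_zero hs)
  calc 2 / ε ≤ ψ ε / t * φ 1 := by
        rw [div_mul_eq_mul_div, div_le_div_iff₀ hε ht]; linarith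
    _ ≤ ψ d / t * φ 1 := by gcongr

/-- If `W_θ(μ,ν) = 0`, some coupling gives mass at most `ε` to the pairs at distance
at least `ε`. -/
theorem exists_mem_couplings_of_WTheta_eq_zero [BorelSpace X] [SecondCountableTopology X]
    {θ φ ψ : ℝ → ℝ} (hfact : CCFactorization θ φ ψ) {μ ν : Measure X} (hW : WTheta φ ψ μ ν = 0)
    {ε : ℝ} (hε : 0 < ε) :
    ∃ q ∈ Couplings μ ν, q {p | ε ≤ dist p.1 p.2} ≤ ENNReal.ofReal ε := by
  obtain ⟨δ, hδ, hcost⟩ := hfact.exists_forall_two_div_le hε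
  obtain ⟨t, ⟨ht0, htop, hinf⟩, htδ⟩ :=
    sInf_lt_iff.1 (hW.trans_lt (ENNReal.ofReal_pos.2 hδ))
  obtain ⟨q, hq⟩ := iInf_lt_iff.1 (hinf.trans_lt ENNReal.one_lt_two)
  obtain ⟨hqc, hq⟩ := iInf_lt_iff.1 hq
  refine ⟨q, hqc, ?_⟩
  set S : Set (X × X) := {p | ε ≤ dist p.1 p.2}
  have hS : ENNReal.ofReal (2 / ε) * q S ≤ 2 := calc
    ENNReal.ofReal (2 / ε) * q S = ∫⁻ _ in S, ENNReal.ofReal (2 / ε) ∂q :=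
      (setLIntegral_const _ _).symm
    _ ≤ ∫⁻ p in S, ENNReal.ofReal (φ (ψ (dist p.1 p.2) / t.toReal)) ∂q :=
      setLIntegral_mono' (measurableSet_le_dist ε) fun p hp ↦ ENNReal.ofReal_le_ofReal <|
        hcost _ (ENNReal.toReal_pos ht0.ne' htop) ((ENNReal.lt_ofReal_iff_toReal_lt htop).1 htδ) _ hp
    _ ≤ 2 := (setLIntegral_le_lintegral _ _).trans hq.le
  calc q S ≤ 2 / ENNReal.ofReal (2 / ε) := by
        rw [ENNReal.le_div_iff_mul_le (by simp [hε]) (by simp), mul_comm]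
        exact hS
    _ = ENNReal.ofReal ε := by
        rw [← ENNReal.ofReal_ofNat 2, ← ENNReal.ofReal_div_of_pos (by positivity)]
        congr 1
        field_simp

theorem eq_of_WTheta_eq_zero [BorelSpace X] [SecondCountableTopology X]
    {θ φ ψ : ℝ → ℝ} (hfact : CCFactorization θ φ ψ) {μ ν : Measure X} [IsProbabilityMeasure μ]
    [IsProbabilityMeasure ν] (hW : WTheta φ ψ μ ν = 0) : μ = ν := by
  have hLP : levyProkhorovEDist μ ν = 0 := by
    refine nonpos_iff_eq_zero.1 (levyProkhorovEDist_le_of_forall_le μ ν 0 fun ε B hε hε' hB ↦ ?_)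
    obtain ⟨q, hq, hqS⟩ := exists_mem_couplings_of_WTheta_eq_zero hfact hW
      (ENNReal.toReal_pos hε.ne' hε'.ne)
    rw [ENNReal.ofReal_toReal hε'.ne] at hqS
    exact (measure_le_thickening_add_of_mem_couplings hq hB _).trans (by gcongr)
  refine ext_of_generate_finite {F : Set X | IsClosed F}
    (BorelSpace.measurable_eq.trans borel_eq_generateFrom_isClosed) isPiSystem_isClosed (fun F hF ↦ ?_) (by simp)
  exact measure_eq_measure_of_levyProkhorovEDist_eq_zero_of_isClosed hLP hF
    ⟨1, one_pos, measure_ne_top _ _⟩ ⟨1, one_pos, measure_ne_top _ _⟩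

theorem diagonal_mem_couplings {X : Type*} [MeasurableSpace X] (μ : Measure X) [IsProbabilityMeasure μ] :
    μ.map (fun x ↦ (x, x)) ∈ Couplings μ μ := by
  have hm : Measurable fun x : X ↦ (x, x) := measurable_id.prodMk measurable_id
  refine ⟨Measure.isProbabilityMeasure_map hm.aemeasurable, ?_, ?_⟩
  · rw [Measure.map_map measurable_fst hm]; exact Measure.map_id
  · rw [Measure.map_map measurable_snd hm]; exact Measure.map_id

theorem WTheta_self {φ ψ : ℝ → ℝ} (hφ : φ 0 = 0) (hψ : ψ 0 = 0) (μ : Measure X)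
    [IsProbabilityMeasure μ] : WTheta φ ψ μ μ = 0 := by
  rw [← nonpos_iff_eq_zero, ← csInf_Ioo ENNReal.zero_lt_top]
  refine sInf_le_sInf fun t ⟨ht, ht'⟩ ↦
    ⟨ht, ht'.ne, (iInf₂_le _ (diagonal_mem_couplings μ)).trans ((lintegral_map_le _ _).trans ?_)⟩
  simp [hφ, hψ]

end

/-- `W_θ(μ,ν) = 0` if and only if `μ = ν`. -/
theorem WTheta_eq_zero_iff
    {X : Type*} [MetricSpace X] [CompleteSpace X] [TopologicalSpace.SeparableSpace X]
    [MeasurableSpace X] [BorelSpace X]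
    (θ φ ψ : ℝ → ℝ) (hfact : CCFactorization θ φ ψ)
    (μ ν : Measure X) [IsProbabilityMeasure μ] [IsProbabilityMeasure ν] :
    WTheta φ ψ μ ν = 0 ↔ μ = ν := by
  have : SecondCountableTopology X := UniformSpace.secondCountable_of_separable X
  refine ⟨eq_of_WTheta_eq_zero hfact, ?_⟩
  rintro rfl
  exact WTheta_self hfact.phi_zero hfact.psi_zero μ
end
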